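/- Let Ω₀ ⊆ Ω₁ ⊆ [0,1)^d be Lebesgue measurable sets with |Ω₀| > 0, let γ₀ ∈ ℤ^d be nonzero, and set Ω = Ω₁ ∪ (γ₀ + Ω₀). Let a₂, …, a_m ∈ ℝ^d and set S = 1 + ∑_{j=2}^m e^{2πi⟨a_j, γ₀⟩}. Then the family of exponentials {x ↦ e^{2πi⟨k,x⟩} : k ∈ ℤ^d} ∪ {x ↦ e^{2πi⟨a_j+k, x⟩} : 2 ≤ j ≤ m, k ∈ ℤ^d}, restricted to Ω, is a tight frame of L²(Ω) if and only if S = 0; and in that case the tight frame bound is m, i.e. ∑ over the family of |⟨f, e⟩|² equals m‖f‖² for every f ∈ L²(Ω). -/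

import Mathlib

open MeasureTheory ENNReal

/-- The exponential `x ↦ e^{2πi⟨b, x⟩}` on `ℝ^d`. -/
noncomputable def expChar {d : ℕ} (b : Fin d → ℝ) : (Fin d → ℝ) → ℂ :=
  fun x => Complex.exp (2 * Real.pi * Complex.I * (∑ i, b i * x i))

/-- The fundamental domain `[0,1)^d` of `ℤ^d` in `ℝ^d`. -/
def unitBox (d : ℕ) : Set (Fin d → ℝ) := Set.univ.pi fun _ => Set.Ico (0 : ℝ) 1

/-- The frame sum `∑ᵢ |⟨f, φᵢ⟩|²` of a family `φ` at `f ∈ L²(μ)`. -/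
noncomputable def frameSum {α : Type*} [MeasurableSpace α] (μ : Measure α) {I : Type*}
    (φ : I → α → ℂ) (f : Lp ℂ 2 μ) : ℝ :=
  ∑' i : I, ‖∫ x, f x * (starRingEnd ℂ) (φ i x) ∂μ‖ ^ 2

open scoped ComplexConjugate

section Parseval

/-- The circle `ℝ / ℤ` with its normalised Haar measure, the convention of `UnitAddTorus`. -/
noncomputable local instance : MeasureSpace UnitAddCircle := ⟨AddCircle.haarAddCircle⟩

theorem unitBox_ae_eq_Ioc (d : ℕ) :
    unitBox d =ᵐ[volume] {x : Fin d → ℝ | ∀ i, x i ∈ Set.Ioc (0 : ℝ) (0 + 1)} := by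
  have h1 := Measure.univ_pi_Ico_ae_eq_Icc (μ := fun _ : Fin d => (volume : Measure ℝ))
    (f := fun _ => 0) (g := fun _ => 1)
  have h2 := Measure.univ_pi_Ioc_ae_eq_Icc (μ := fun _ : Fin d => (volume : Measure ℝ))
    (f := fun _ => 0) (g := fun _ => 1)
  have h3 : {x : Fin d → ℝ | ∀ i, x i ∈ Set.Ioc (0 : ℝ) (0 + 1)}
      = Set.univ.pi fun _ => Set.Ioc (0 : ℝ) 1 := by
    ext x; simp
  rw [h3]
  exact h1.trans h2.symm

theorem mFourier_coe {d : ℕ} (k : Fin d → ℤ) (x : Fin d → ℝ) :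
    UnitAddTorus.mFourier k (fun i => (x i : UnitAddCircle)) = expChar (fun i => (k i : ℝ)) x := by
  simp only [UnitAddTorus.mFourier, ContinuousMap.coe_mk, fourier_coe_apply, expChar,
    ← Complex.exp_sum]
  push_cast
  rw [Finset.mul_sum]
  congr 1
  refine Finset.sum_congr rfl fun i _ => ?_
  ring

/-- Parseval's identity for the exponentials with integer frequencies on the unit box. -/
theorem hasSum_sq_integral_unitBox_expChar {d : ℕ} {g : (Fin d → ℝ) → ℂ}
    (hg : MemLp g 2 (volume.restrict (unitBox d))) :
    HasSum (fun k : Fin d → ℤ =>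
        ‖∫ x in unitBox d, g x * conj (expChar (fun i => (k i : ℝ)) x)‖ ^ 2)
      (∫ x in unitBox d, ‖g x‖ ^ 2) := by
  set B : Set (Fin d → ℝ) := {x | ∀ i, x i ∈ Set.Ioc (0 : ℝ) (0 + 1)} with hB
  have hBm : MeasurableSet B := MeasurableSet.univ_pi' fun _ => measurableSet_Ioc
  rw [Measure.restrict_congr_set (unitBox_ae_eq_Ioc d)] at hg ⊢
  set e := UnitAddTorus.measurableEquivPiIoc (fun _ : Fin d => (0 : ℝ)) with he
  set P : UnitAddTorus (Fin d) → (Fin d → ℝ) := fun t => (e t).1 with hP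
  have hPe : MeasurableEmbedding P :=
    (MeasurableEmbedding.subtype_coe hBm).comp e.measurableEmbedding
  have hPm : MeasurePreserving P volume (volume.restrict B) := by
    have h1 := UnitAddTorus.measurePreserving_equivPiIoc (fun _ : Fin d => (0 : ℝ))
    have h2 : MeasurePreserving (Subtype.val : B → Fin d → ℝ)
        (Measure.comap Subtype.val volume) (volume.restrict B) :=
      ⟨measurable_subtype_coe, map_comap_subtype_coe hBm volume⟩
    exact h2.comp h1
  have hPcoe : ∀ t, (fun i => (P t i : UnitAddCircle)) = t := fun t => e.symm_apply_apply t
  have hG : MemLp (g ∘ P) 2 volume := hg.comp_measurePreserving hPm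
  have key := UnitAddTorus.hasSum_sq_mFourierCoeff (hG.toLp (g ∘ P))
  have hnorm : ∫ t, ‖hG.toLp (g ∘ P) t‖ ^ 2 = ∫ x in B, ‖g x‖ ^ 2 := by
    rw [← hPm.integral_comp hPe]
    refine integral_congr_ae ?_
    filter_upwards [hG.coeFn_toLp] with t ht
    rw [ht]; rfl
  have hcoeff : ∀ k, UnitAddTorus.mFourierCoeff (hG.toLp (g ∘ P)) k
      = ∫ x in B, g x * conj (expChar (fun i => (k i : ℝ)) x) := by
    intro k
    rw [← hPm.integral_comp hPe]
    refine integral_congr_ae ?_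
    filter_upwards [hG.coeFn_toLp] with t ht
    rw [ht, UnitAddTorus.mFourier_neg, ← mFourier_coe, hPcoe, smul_eq_mul, mul_comm]
    rfl
  simpa only [hnorm, hcoeff] using key

end Parseval

theorem continuous_expChar {d : ℕ} (b : Fin d → ℝ) : Continuous (expChar b) := by
  unfold expChar; fun_prop

theorem norm_expChar {d : ℕ} (b x : Fin d → ℝ) : ‖expChar b x‖ = 1 := by
  rw [expChar, show 2 * (Real.pi : ℂ) * Complex.I * (∑ i, b i * x i : ℝ)
    = ((2 * Real.pi * ∑ i, b i * x i : ℝ) : ℂ) * Complex.I by push_cast; ring]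
  exact Complex.norm_exp_ofReal_mul_I _

theorem expChar_add_left {d : ℕ} (b c x : Fin d → ℝ) :
    expChar (b + c) x = expChar b x * expChar c x := by
  simp only [expChar, ← Complex.exp_add, ← mul_add, Pi.add_apply]
  push_cast
  simp only [add_mul, Finset.sum_add_distrib]

theorem expChar_add_right {d : ℕ} (b x y : Fin d → ℝ) :
    expChar b (x + y) = expChar b x * expChar b y := by
  simp only [expChar, ← Complex.exp_add, Pi.add_apply]
  push_cast
  simp only [mul_add, Finset.sum_add_distrib]

theorem expChar_intCast_intCast {d : ℕ} (k l : Fin d → ℤ) :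
    expChar (fun i => (k i : ℝ)) (fun i => (l i : ℝ)) = 1 := by
  rw [expChar, Complex.exp_eq_one_iff]
  refine ⟨∑ i, k i * l i, ?_⟩
  push_cast
  ring

theorem volume_unitBox (d : ℕ) : volume (unitBox d) = 1 := by
  simp [unitBox, volume_pi_pi]

/-- A square-integrable function has the squared `L²`-norm `∫ ‖h‖²`. -/
theorem norm_toLp_sq {α : Type*} [MeasurableSpace α] {μ : Measure α} {h : α → ℂ}
    (hh : MemLp h 2 μ) : ‖hh.toLp h‖ ^ 2 = ∫ x, ‖h x‖ ^ 2 ∂μ := by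
  have h1 : inner ℂ (hh.toLp h) (hh.toLp h) = ((∫ x, ‖h x‖ ^ 2 ∂μ : ℝ) : ℂ) := by
    rw [L2.inner_def, ← integral_complex_ofReal]
    refine integral_congr_ae ?_
    filter_upwards [hh.coeFn_toLp] with x hx
    rw [hx, inner_self_eq_norm_sq_to_K]
    simp
  rw [inner_self_eq_norm_sq_to_K] at h1
  rw [← Complex.ofReal_inj, ← h1]
  simp

theorem frameSum_toLp {α : Type*} [MeasurableSpace α] {μ : Measure α} {I : Type*}
    (φ : I → α → ℂ) {h : α → ℂ} (hh : MemLp h 2 μ) :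
    frameSum μ φ (hh.toLp h) = ∑' i : I, ‖∫ x, h x * conj (φ i x) ∂μ‖ ^ 2 := by
  unfold frameSum
  congr! 4 with i
  refine integral_congr_ae ?_
  filter_upwards [hh.coeFn_toLp] with x hx
  rw [hx]

section TwoTiles

variable {d : ℕ} {Ω₀ Ω₁ : Set (Fin d → ℝ)} {γ : Fin d → ℤ}

theorem disjoint_of_subset_unitBox (h0 : Ω₀ ⊆ unitBox d) (h1 : Ω₁ ⊆ unitBox d) (hγ : γ ≠ 0) :
    Disjoint Ω₁ {x : Fin d → ℝ | (fun i => x i - (γ i : ℝ)) ∈ Ω₀} := by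
  rw [Set.disjoint_left]
  intro x hx hx'
  refine hγ (funext fun i => ?_)
  have ha := h1 hx i (Set.mem_univ i)
  have hb := h0 hx' i (Set.mem_univ i)
  simp only [Set.mem_Ico] at ha hb
  have hlt : (γ i : ℝ) < 1 := by linarith
  have hgt : (-1 : ℝ) < γ i := by linarith
  have hlt' : γ i < 1 := by exact_mod_cast hlt
  have hgt' : -1 < γ i := by exact_mod_cast hgt
  simp only [Pi.zero_apply]
  omega

theorem measurableSet_translate (hΩ₀ : MeasurableSet Ω₀) :
    MeasurableSet {x : Fin d → ℝ | (fun i => x i - (γ i : ℝ)) ∈ Ω₀} :=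
  hΩ₀.preimage (f := fun x : Fin d → ℝ => fun i => x i - (γ i : ℝ)) (by fun_prop)

/-- Translation by `γ` maps Lebesgue measure on `Ω₀` to Lebesgue measure on `γ + Ω₀`. -/
theorem measurePreserving_translate (hΩ₀ : MeasurableSet Ω₀) :
    MeasurePreserving (fun x : Fin d → ℝ => x + fun i => (γ i : ℝ)) (volume.restrict Ω₀)
      (volume.restrict {x : Fin d → ℝ | (fun i => x i - (γ i : ℝ)) ∈ Ω₀}) := by
  have h := (measurePreserving_add_right (volume : Measure (Fin d → ℝ))
    (fun i => (γ i : ℝ))).restrict_preimage (measurableSet_translate (γ := γ) hΩ₀)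
  convert h using 2
  ext x
  simp

/-- An integral over `Ω₁ ∪ (γ + Ω₀)` is the sum of integrals over `Ω₁` and `Ω₀`. -/
theorem integral_union_translate {E : Type*} [NormedAddCommGroup E] [NormedSpace ℝ E]
    (hΩ₀ : MeasurableSet Ω₀)
    (hdisj : Disjoint Ω₁ {x : Fin d → ℝ | (fun i => x i - (γ i : ℝ)) ∈ Ω₀})
    {h : (Fin d → ℝ) → E}
    (hh : IntegrableOn h (Ω₁ ∪ {x : Fin d → ℝ | (fun i => x i - (γ i : ℝ)) ∈ Ω₀})) :
    ∫ x in Ω₁ ∪ {x : Fin d → ℝ | (fun i => x i - (γ i : ℝ)) ∈ Ω₀}, h x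
      = (∫ x in Ω₁, h x) + ∫ x in Ω₀, h (x + fun i => (γ i : ℝ)) := by
  rw [setIntegral_union hdisj (measurableSet_translate hΩ₀) hh.left_of_union hh.right_of_union,
    ← (measurePreserving_translate hΩ₀).integral_comp
      (MeasurableEquiv.addRight (fun i => (γ i : ℝ))).measurableEmbedding]

theorem volume_union_translate_ne_top (hΩ₀ : MeasurableSet Ω₀)
    (h0 : Ω₀ ⊆ unitBox d) (h1 : Ω₁ ⊆ unitBox d) :
    volume (Ω₁ ∪ {x : Fin d → ℝ | (fun i => x i - (γ i : ℝ)) ∈ Ω₀}) ≠ ∞ := by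
  have hbox : ∀ {s : Set (Fin d → ℝ)}, s ⊆ unitBox d → volume s ≠ ∞ := fun hs =>
    measure_ne_top_of_subset hs (by simp [volume_unitBox])
  refine measure_union_ne_top (hbox h1) ?_
  have h := (measurePreserving_translate (γ := γ) hΩ₀).measure_preimage
    (s := Set.univ) MeasurableSet.univ.nullMeasurableSet
  simp only [Set.preimage_univ, Measure.restrict_apply_univ] at h
  rw [← h]
  exact hbox h0

theorem memLp_two_translate (hΩ₀ : MeasurableSet Ω₀) {h : (Fin d → ℝ) → ℂ}
    (hh : MemLp h 2
      (volume.restrict (Ω₁ ∪ {x : Fin d → ℝ | (fun i => x i - (γ i : ℝ)) ∈ Ω₀}))) :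
    MemLp (fun x => h (x + fun i => (γ i : ℝ))) 2 (volume.restrict Ω₀) :=
  (hh.mono_measure (Measure.restrict_mono Set.subset_union_right le_rfl)).comp_measurePreserving
    (measurePreserving_translate hΩ₀)

theorem setIntegral_unitBox_indicator {E : Type*} [NormedAddCommGroup E] [NormedSpace ℝ E]
    {s : Set (Fin d → ℝ)} (hs : MeasurableSet s) (hsb : s ⊆ unitBox d) (F : (Fin d → ℝ) → E) :
    ∫ x in unitBox d, s.indicator F x = ∫ x in s, F x := by
  rw [setIntegral_indicator hs, Set.inter_eq_self_of_subset_right hsb]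

/-- Expansion of `‖z + w ū‖²` for unimodular `u`. -/
theorem norm_add_conj_mul_sq (z w u : ℂ) (hu : ‖u‖ = 1) :
    ‖z + w * conj u‖ ^ 2 = ‖z‖ ^ 2 + ‖w‖ ^ 2 + 2 * (u * (z * conj w)).re := by
  simp only [← Complex.normSq_eq_norm_sq] at *
  rw [Complex.normSq_add, Complex.normSq_mul, Complex.normSq_conj, Complex.normSq_eq_norm_sq u, hu]
  simp only [map_mul, Complex.conj_conj]
  rw [show z * (conj w * u) = u * (z * conj w) by ring]
  ring

/-- The exponentials with frequencies in `b + ℤ^d`: sum of the squared coefficients of a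
square-integrable function on `Ω₁ ∪ (γ + Ω₀)`. -/
theorem hasSum_sq_integral_union_translate
    (hΩ₀ : MeasurableSet Ω₀) (hΩ₁ : MeasurableSet Ω₁) (h01 : Ω₀ ⊆ Ω₁) (h1 : Ω₁ ⊆ unitBox d)
    (hγ : γ ≠ 0) (b : Fin d → ℝ) {h : (Fin d → ℝ) → ℂ}
    (hh : MemLp h 2
      (volume.restrict (Ω₁ ∪ {x : Fin d → ℝ | (fun i => x i - (γ i : ℝ)) ∈ Ω₀}))) :
    HasSum (fun k : Fin d → ℤ =>
        ‖∫ x in Ω₁ ∪ {x : Fin d → ℝ | (fun i => x i - (γ i : ℝ)) ∈ Ω₀},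
          h x * conj (expChar (b + fun i => (k i : ℝ)) x)‖ ^ 2)
      ((∫ x in Ω₁ ∪ {x : Fin d → ℝ | (fun i => x i - (γ i : ℝ)) ∈ Ω₀}, ‖h x‖ ^ 2)
        + 2 * (expChar b (fun i => (γ i : ℝ)) *
          ∫ x in Ω₀, h x * conj (h (x + fun i => (γ i : ℝ)))).re) := by
  set v : Fin d → ℝ := fun i => (γ i : ℝ) with hv
  set Ω : Set (Fin d → ℝ) := Ω₁ ∪ {x : Fin d → ℝ | (fun i => x i - (γ i : ℝ)) ∈ Ω₀} with hΩ
  have h0 : Ω₀ ⊆ unitBox d := h01.trans h1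
  have hdisj := disjoint_of_subset_unitBox h0 h1 hγ
  have hfin : IsFiniteMeasure (volume.restrict Ω) :=
    isFiniteMeasure_restrict.2 (volume_union_translate_ne_top hΩ₀ h0 h1)
  have hh1 : MemLp h 2 (volume.restrict Ω₁) :=
    hh.mono_measure (Measure.restrict_mono Set.subset_union_left le_rfl)
  have hh0 : MemLp h 2 (volume.restrict Ω₀) :=
    hh1.mono_measure (Measure.restrict_mono h01 le_rfl)
  have hhT : MemLp (fun x => h (x + v)) 2 (volume.restrict Ω₀) := memLp_two_translate hΩ₀ hh
  set u := expChar b v with hu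
  -- `g` is the periodization of `h` times the conjugate of the exponential of frequency `b`
  set f₁ : (Fin d → ℝ) → ℂ := Ω₁.indicator h with hf₁
  set f₂ : (Fin d → ℝ) → ℂ := Ω₀.indicator (fun x => h (x + v)) with hf₂
  have hf₁L : MemLp f₁ 2 volume := (memLp_indicator_iff_restrict hΩ₁).2 hh1
  have hf₂L : MemLp f₂ 2 volume := (memLp_indicator_iff_restrict hΩ₀).2 hhT
  set g : (Fin d → ℝ) → ℂ := fun x => (f₁ x + f₂ x * conj u) * conj (expChar b x) with hg
  have bdd_conj : ∀ c : Fin d → ℝ, Continuous fun x => conj (expChar c x) := fun c =>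
    Complex.continuous_conj.comp (continuous_expChar c)
  have hsum : MemLp (fun x => f₁ x + f₂ x * conj u) 2 (volume : Measure (Fin d → ℝ)) :=
    hf₁L.add (hf₂L.mul_const _)
  have hgL : MemLp g 2 (volume.restrict (unitBox d)) := by
    refine (hsum.restrict _).of_le (hsum.1.restrict.mul (bdd_conj b).aestronglyMeasurable)
      (Filter.Eventually.of_forall fun x => ?_)
    simp [hg, norm_expChar]
  have key := hasSum_sq_integral_unitBox_expChar hgL
  have hmulint : ∀ {s : Set (Fin d → ℝ)} {F : (Fin d → ℝ) → ℂ} (c : Fin d → ℝ),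
      IntegrableOn F s → IntegrableOn (fun x => F x * conj (expChar c x)) s := by
    intro s F c hF
    refine Integrable.mono hF (hF.1.mul (bdd_conj c).aestronglyMeasurable)
      (Filter.Eventually.of_forall fun x => ?_)
    simp [norm_expChar]
  have hhi : IntegrableOn h Ω := hh.integrable one_le_two
  have hfin₀ : IsFiniteMeasure (volume.restrict Ω₀) :=
    isFiniteMeasure_restrict.2 (measure_ne_top_of_subset h0 (by simp [volume_unitBox]))
  have hhTi : IntegrableOn (fun x => h (x + v)) Ω₀ := hhT.integrable one_le_two
  have hcoeff : ∀ k : Fin d → ℤ,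
      ∫ x in unitBox d, g x * conj (expChar (fun i => (k i : ℝ)) x)
        = ∫ x in Ω, h x * conj (expChar (b + fun i => (k i : ℝ)) x) := by
    intro k
    set c : Fin d → ℝ := b + fun i => (k i : ℝ) with hc
    have hcv : expChar c v = u := by
      rw [hc, expChar_add_left, hv, expChar_intCast_intCast, mul_one]
    rw [integral_union_translate hΩ₀ hdisj (hmulint c hhi),
      ← setIntegral_unitBox_indicator hΩ₁ h1, ← setIntegral_unitBox_indicator hΩ₀ h0,
      ← integral_add]
    · refine integral_congr_ae (Filter.Eventually.of_forall fun x => ?_)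
      have hcx : expChar c x = expChar b x * expChar (fun i => (k i : ℝ)) x :=
        expChar_add_left _ _ _
      have hcxv : expChar c (x + v) = expChar c x * u := by rw [expChar_add_right, hcv]
      by_cases hx0 : x ∈ Ω₀
      · simp only [hg, hf₁, hf₂, Set.indicator_of_mem hx0, Set.indicator_of_mem (h01 hx0), ← hv,
          hcxv, hcx, map_mul]
        ring
      · by_cases hx1 : x ∈ Ω₁
        · simp only [hg, hf₁, hf₂, Set.indicator_of_mem hx1, Set.indicator_of_notMem hx0,
            hcx, map_mul]
          ring
        · simp [hg, hf₁, hf₂, hx0, hx1]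
    · exact ((hmulint c hhi.left_of_union).integrable_indicator hΩ₁).integrableOn
    · refine Integrable.integrableOn (IntegrableOn.integrable_indicator ?_ hΩ₀)
      have := (hmulint c hhTi).mul_const (conj u)
      refine this.congr (Filter.Eventually.of_forall fun x => ?_)
      simp only
      rw [← hv, expChar_add_right, hcv, map_mul]
      ring
  have hsq : ∀ {s : Set (Fin d → ℝ)} {F : (Fin d → ℝ) → ℂ}, MemLp F 2 (volume.restrict s) →
      IntegrableOn (fun x => ‖F x‖ ^ 2) s := fun hF => hF.integrable_norm_pow two_ne_zero
  have hprod : IntegrableOn (fun x => h x * conj (h (x + v))) Ω₀ :=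
    hh0.integrable_mul hhT.star
  have hnorm : ∫ x in unitBox d, ‖g x‖ ^ 2 = (∫ x in Ω, ‖h x‖ ^ 2)
      + 2 * (u * ∫ x in Ω₀, h x * conj (h (x + v))).re := by
    have hcross : 2 * (u * ∫ x in Ω₀, h x * conj (h (x + v))).re
        = ∫ x in Ω₀, 2 * (u * (h x * conj (h (x + v)))).re := by
      rw [integral_const_mul, ← integral_const_mul]
      congr 1
      exact (integral_re (hprod.const_mul u)).symm
    have hI1 : IntegrableOn (Ω₁.indicator fun x => ‖h x‖ ^ 2) (unitBox d) :=
      ((hsq hh1).integrable_indicator hΩ₁).integrableOn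
    have hI2 : IntegrableOn (Ω₀.indicator fun x => ‖h (x + v)‖ ^ 2) (unitBox d) :=
      ((hsq hhT).integrable_indicator hΩ₀).integrableOn
    have hI3 : IntegrableOn
        (Ω₀.indicator fun x => 2 * (u * (h x * conj (h (x + v)))).re) (unitBox d) :=
      (IntegrableOn.integrable_indicator
        ((hprod.const_mul u).re.const_mul 2) hΩ₀).integrableOn
    have hI12 : IntegrableOn (fun x => Ω₁.indicator (fun x => ‖h x‖ ^ 2) x
        + Ω₀.indicator (fun x => ‖h (x + v)‖ ^ 2) x) (unitBox d) := hI1.add hI2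
    rw [integral_union_translate hΩ₀ hdisj (hsq hh), hcross, ← setIntegral_unitBox_indicator hΩ₁ h1,
      ← setIntegral_unitBox_indicator hΩ₀ h0, ← setIntegral_unitBox_indicator hΩ₀ h0,
      ← integral_add hI1 hI2,
      ← integral_add hI12 hI3]
    refine integral_congr_ae (Filter.Eventually.of_forall fun x => ?_)
    simp only [hg, norm_mul, RCLike.norm_conj, norm_expChar, mul_one]
    rw [norm_add_conj_mul_sq _ _ _ (norm_expChar b v)]
    by_cases hx0 : x ∈ Ω₀
    · simp [hf₁, hf₂, hx0, h01 hx0, hv, hu]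
    · by_cases hx1 : x ∈ Ω₁ <;> simp [hf₁, hf₂, hx0, hx1]
  simpa only [hnorm, hcoeff] using key

/-- The frame sum over all frequencies in `⋃ⱼ (aⱼ + ℤ^d)`. -/
theorem frameSum_union_translate {m : ℕ}
    (hΩ₀ : MeasurableSet Ω₀) (hΩ₁ : MeasurableSet Ω₁) (h01 : Ω₀ ⊆ Ω₁) (h1 : Ω₁ ⊆ unitBox d)
    (hγ : γ ≠ 0) (a : Fin m → Fin d → ℝ) {h : (Fin d → ℝ) → ℂ}
    (hh : MemLp h 2
      (volume.restrict (Ω₁ ∪ {x : Fin d → ℝ | (fun i => x i - (γ i : ℝ)) ∈ Ω₀}))) :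
    frameSum (volume.restrict (Ω₁ ∪ {x : Fin d → ℝ | (fun i => x i - (γ i : ℝ)) ∈ Ω₀}))
        (fun p : Fin m × (Fin d → ℤ) => expChar (a p.1 + fun i => (p.2 i : ℝ))) (hh.toLp h)
      = m * ‖hh.toLp h‖ ^ 2
        + 2 * ((∑ j, expChar (a j) (fun i => (γ i : ℝ))) *
          ∫ x in Ω₀, h x * conj (h (x + fun i => (γ i : ℝ)))).re := by
  have hj := fun j => hasSum_sq_integral_union_translate hΩ₀ hΩ₁ h01 h1 hγ (a j) hh
  have hsummable : Summable fun p : Fin m × (Fin d → ℤ) =>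
      ‖∫ x in Ω₁ ∪ {x : Fin d → ℝ | (fun i => x i - (γ i : ℝ)) ∈ Ω₀},
        h x * conj (expChar (a p.1 + fun i => (p.2 i : ℝ)) x)‖ ^ 2 :=
    (summable_prod_of_nonneg fun _ => by positivity).2
      ⟨fun j => (hj j).summable, Summable.of_finite⟩
  rw [frameSum_toLp, norm_toLp_sq, hsummable.tsum_prod' fun j => (hj j).summable, tsum_fintype]
  simp only [fun j => (hj j).tsum_eq]
  rw [Finset.sum_add_distrib, ← Finset.mul_sum, Finset.sum_mul, Complex.re_sum]
  simp

/-- A square-integrable function equal to `1` on `Ω₀`, to `c` on `γ + Ω₀` and to `0` on the rest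
of `Ω₁`. -/
theorem exists_memLp_two_tiles (hΩ₀ : MeasurableSet Ω₀) (h01 : Ω₀ ⊆ Ω₁)
    (hdisj : Disjoint Ω₁ {x : Fin d → ℝ | (fun i => x i - (γ i : ℝ)) ∈ Ω₀})
    [IsFiniteMeasure (volume.restrict
      (Ω₁ ∪ {x : Fin d → ℝ | (fun i => x i - (γ i : ℝ)) ∈ Ω₀}))] (c : ℂ) :
    ∃ h : (Fin d → ℝ) → ℂ,
      MemLp h 2 (volume.restrict (Ω₁ ∪ {x : Fin d → ℝ | (fun i => x i - (γ i : ℝ)) ∈ Ω₀})) ∧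
      (∀ x ∈ Ω₁, h x = Ω₀.indicator (fun _ => 1) x) ∧
      ∀ x ∈ Ω₀, h (x + fun i => (γ i : ℝ)) = c := by
  have hone : MemLp (Ω₀.indicator fun _ => (1 : ℂ)) 2 (volume.restrict
      (Ω₁ ∪ {x : Fin d → ℝ | (fun i => x i - (γ i : ℝ)) ∈ Ω₀})) :=
    MemLp.indicator hΩ₀ (memLp_const (1 : ℂ))
  have hc : MemLp ({x : Fin d → ℝ | (fun i => x i - (γ i : ℝ)) ∈ Ω₀}.indicator fun _ => c) 2
      (volume.restrict (Ω₁ ∪ {x : Fin d → ℝ | (fun i => x i - (γ i : ℝ)) ∈ Ω₀})) :=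
    MemLp.indicator (measurableSet_translate hΩ₀) (memLp_const c)
  refine ⟨Ω₀.indicator (fun _ => 1) +
      {x : Fin d → ℝ | (fun i => x i - (γ i : ℝ)) ∈ Ω₀}.indicator (fun _ => c),
    hone.add hc, fun x hx => ?_, fun x hx => ?_⟩
  · rw [Pi.add_apply, Set.indicator_of_notMem (Set.disjoint_left.1 hdisj hx), add_zero]
  · have hxT : (x + fun i => (γ i : ℝ)) ∈
        {x : Fin d → ℝ | (fun i => x i - (γ i : ℝ)) ∈ Ω₀} := by simpa using hx
    rw [Pi.add_apply, Set.indicator_of_mem hxT, Set.indicator_of_notMem, zero_add]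
    exact fun hx' => Set.disjoint_left.1 hdisj (h01 hx') hxT

/-- On the test functions equal to `1` on `Ω₀`, to `c` on `γ + Ω₀` and to `0` elsewhere, a tight
frame bound forces an identity between `C`, `m`, `c` and the exponential sum. -/
theorem tightFrame_bound_test {m : ℕ}
    (hΩ₀ : MeasurableSet Ω₀) (hΩ₁ : MeasurableSet Ω₁) (h01 : Ω₀ ⊆ Ω₁) (h1 : Ω₁ ⊆ unitBox d)
    (hΩ₀pos : 0 < volume Ω₀) (hγ : γ ≠ 0) (a : Fin m → Fin d → ℝ) {C : ℝ}
    (hC : ∀ f : Lp ℂ 2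
        (volume.restrict (Ω₁ ∪ {x : Fin d → ℝ | (fun i => x i - (γ i : ℝ)) ∈ Ω₀})),
      frameSum (volume.restrict (Ω₁ ∪ {x : Fin d → ℝ | (fun i => x i - (γ i : ℝ)) ∈ Ω₀}))
        (fun p : Fin m × (Fin d → ℤ) => expChar (a p.1 + fun i => (p.2 i : ℝ))) f
        = C * ‖f‖ ^ 2) (c : ℂ) :
    C * (1 + ‖c‖ ^ 2) = m * (1 + ‖c‖ ^ 2)
      + 2 * ((∑ j, expChar (a j) (fun i => (γ i : ℝ))) * conj c).re := by
  have h0 : Ω₀ ⊆ unitBox d := h01.trans h1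
  have hdisj := disjoint_of_subset_unitBox h0 h1 hγ
  have hfin : IsFiniteMeasure (volume.restrict
      (Ω₁ ∪ {x : Fin d → ℝ | (fun i => x i - (γ i : ℝ)) ∈ Ω₀})) :=
    isFiniteMeasure_restrict.2 (volume_union_translate_ne_top hΩ₀ h0 h1)
  obtain ⟨h, hh, hval₁, hval₂⟩ := exists_memLp_two_tiles hΩ₀ h01 hdisj c
  have hne : volume.real Ω₀ ≠ 0 :=
    (ENNReal.toReal_pos hΩ₀pos.ne' (measure_ne_top_of_subset h0 (by simp [volume_unitBox]))).ne'
  have hnorm : ‖hh.toLp h‖ ^ 2 = volume.real Ω₀ * (1 + ‖c‖ ^ 2) := by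
    have hone : ∫ x in Ω₁, ‖h x‖ ^ 2 = ∫ x in Ω₁, Ω₀.indicator (fun _ => (1 : ℝ)) x := by
      refine setIntegral_congr_fun hΩ₁ fun x hx => ?_
      by_cases hx0 : x ∈ Ω₀ <;> simp [hval₁ x hx, hx0]
    have hc : ∫ x in Ω₀, ‖h (x + fun i => (γ i : ℝ))‖ ^ 2 = ∫ _ in Ω₀, ‖c‖ ^ 2 :=
      setIntegral_congr_fun hΩ₀ fun x hx => by simp only [hval₂ x hx]
    have hint : IntegrableOn (fun x => ‖h x‖ ^ 2)
        (Ω₁ ∪ {x : Fin d → ℝ | (fun i => x i - (γ i : ℝ)) ∈ Ω₀}) :=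
      hh.integrable_norm_pow two_ne_zero
    rw [norm_toLp_sq, integral_union_translate hΩ₀ hdisj hint, hone, hc,
      setIntegral_indicator hΩ₀, Set.inter_eq_self_of_subset_right h01, setIntegral_const,
      setIntegral_const, smul_eq_mul, smul_eq_mul]
    ring
  have hcross : ∫ x in Ω₀, h x * conj (h (x + fun i => (γ i : ℝ)))
      = (volume.real Ω₀ : ℂ) * conj c := by
    have hc : ∫ x in Ω₀, h x * conj (h (x + fun i => (γ i : ℝ))) = ∫ _ in Ω₀, conj c :=
      setIntegral_congr_fun hΩ₀ fun x hx => by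
        simp only [hval₂ x hx, hval₁ x (h01 hx), Set.indicator_of_mem hx, one_mul]
    rw [hc, setIntegral_const, Complex.real_smul]
  have key := (hC (hh.toLp h)).symm.trans (frameSum_union_translate hΩ₀ hΩ₁ h01 h1 hγ a hh)
  rw [hnorm, hcross, mul_left_comm (∑ j, _), Complex.re_ofReal_mul] at key
  refine mul_left_cancel₀ hne ?_
  linarith

end TwoTiles

/-- Example: for `Ω = Ω₁ ∪ (γ₀ + Ω₀)` with `Ω₀ ⊆ Ω₁ ⊆ [0,1)^d`, `|Ω₀| > 0`, `0 ≠ γ₀ ∈ ℤ^d`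
and `a₁ = 0`, the exponentials `e^{2πi⟨a_j + k, ·⟩}`, `1 ≤ j ≤ m`, `k ∈ ℤ^d`, form a tight
frame of `L²(Ω)` iff `S = ∑ⱼ e^{2πi⟨a_j, γ₀⟩} = 0`, in which case the tight frame bound
is `m`. -/
theorem example_tight_frame_iff
    (d m : ℕ) [NeZero m]
    (Ω₀ Ω₁ : Set (Fin d → ℝ)) (hΩ₀meas : MeasurableSet Ω₀) (hΩ₁meas : MeasurableSet Ω₁)
    (h01 : Ω₀ ⊆ Ω₁) (h1box : Ω₁ ⊆ unitBox d) (hΩ₀pos : 0 < volume Ω₀)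
    (γ₀ : Fin d → ℤ) (hγ₀ : γ₀ ≠ 0)
    (a : Fin m → (Fin d → ℝ)) (ha0 : a 0 = 0) :
    ((∃ C : ℝ, 0 < C ∧
        ∀ f : Lp ℂ 2 (volume.restrict (Ω₁ ∪ {x : Fin d → ℝ | (fun i => x i - (γ₀ i : ℝ)) ∈ Ω₀})),
          frameSum (volume.restrict (Ω₁ ∪ {x : Fin d → ℝ | (fun i => x i - (γ₀ i : ℝ)) ∈ Ω₀}))
            (fun p : Fin m × (Fin d → ℤ) => expChar (a p.1 + fun i => (p.2 i : ℝ))) f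
          = C * ‖f‖ ^ 2)
      ↔ (∑ j : Fin m, Complex.exp (2 * Real.pi * Complex.I * ∑ i, a j i * (γ₀ i : ℝ))) = 0) ∧
    ((∑ j : Fin m, Complex.exp (2 * Real.pi * Complex.I * ∑ i, a j i * (γ₀ i : ℝ))) = 0 →
      ∀ f : Lp ℂ 2 (volume.restrict (Ω₁ ∪ {x : Fin d → ℝ | (fun i => x i - (γ₀ i : ℝ)) ∈ Ω₀})),
        frameSum (volume.restrict (Ω₁ ∪ {x : Fin d → ℝ | (fun i => x i - (γ₀ i : ℝ)) ∈ Ω₀}))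
          (fun p : Fin m × (Fin d → ℤ) => expChar (a p.1 + fun i => (p.2 i : ℝ))) f
        = (m : ℝ) * ‖f‖ ^ 2) := by
  have hbound : (∑ j : Fin m, Complex.exp (2 * Real.pi * Complex.I * ∑ i, a j i * (γ₀ i : ℝ))) = 0 →
      ∀ f : Lp ℂ 2 (volume.restrict (Ω₁ ∪ {x : Fin d → ℝ | (fun i => x i - (γ₀ i : ℝ)) ∈ Ω₀})),
        frameSum (volume.restrict (Ω₁ ∪ {x : Fin d → ℝ | (fun i => x i - (γ₀ i : ℝ)) ∈ Ω₀}))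
          (fun p : Fin m × (Fin d → ℤ) => expChar (a p.1 + fun i => (p.2 i : ℝ))) f
        = (m : ℝ) * ‖f‖ ^ 2 := by
    intro hS f
    change ∑ j, expChar (a j) (fun i => (γ₀ i : ℝ)) = 0 at hS
    have h := frameSum_union_translate hΩ₀meas hΩ₁meas h01 h1box hγ₀ a (Lp.memLp f)
    rw [hS, Lp.toLp_coeFn] at h
    simpa using h
  refine ⟨⟨?_, fun hS => ⟨m, Nat.cast_pos.2 (NeZero.pos m), hbound hS⟩⟩, hbound⟩
  rintro ⟨C, -, hC⟩
  change ∑ j, expChar (a j) (fun i => (γ₀ i : ℝ)) = 0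
  have htest := tightFrame_bound_test hΩ₀meas hΩ₁meas h01 h1box hΩ₀pos hγ₀ a hC
  have hCm : C = m := by simpa using htest 0
  have hS := htest (∑ j, expChar (a j) (fun i => (γ₀ i : ℝ)))
  rw [hCm, Complex.mul_conj, Complex.ofReal_re] at hS
  exact Complex.normSq_eq_zero.1 (by linarith)
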